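/- Let I ⊆ ℝ be an interval with non-empty interior and κ : I → ℝ^d locally integrable. Define the linear functional H(f) = ∫_I κ(t)ᵀ f(t) dt on the space of smooth compactly supported functions f : I → ℝ^d. If H is continuous with respect to the topology of pointwise convergence (i.e., H(f_n) → H(f) whenever f_n(t) → f(t) for every t ∈ I with f_n smooth compactly supported), then κ = 0 Lebesgue-almost everywhere, and hence H is identically zero. -/

import Mathlib

open Filter MeasureTheory RealInnerProductSpace

/-- Smooth compactly supported function on the interval `I` (extended by zero outside). -/
def IsTestFun {d : ℕ} (I : Set ℝ) (f : ℝ → EuclideanSpace ℝ (Fin d)) : Prop :=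
  ContDiff ℝ (⊤ : ℕ∞) f ∧ HasCompactSupport f ∧ tsupport f ⊆ I

/-- A locally integrable function that does not vanish a.e. on an open subset `U` of `I` pairs to `1`
with some test function supported in `U`. -/
lemma exists_isTestFun_integral_inner_eq_one {d : ℕ} {I U : Set ℝ} (hU : IsOpen U) (hUI : U ⊆ I)
    {κ : ℝ → EuclideanSpace ℝ (Fin d)} (hκ : LocallyIntegrableOn κ I volume)
    (hne : ¬ ∀ᵐ t ∂volume, t ∈ U → κ t = 0) :
    ∃ f : ℝ → EuclideanSpace ℝ (Fin d), IsTestFun I f ∧ (∀ t ∉ U, f t = 0) ∧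
      ∫ t in I, ⟪κ t, f t⟫ = 1 := by
  have hκU := hκ.mono_set hUI
  obtain ⟨g, hg, hgc, hgU, hv⟩ : ∃ g : ℝ → ℝ, ContDiff ℝ (⊤ : ℕ∞) g ∧ HasCompactSupport g ∧
      tsupport g ⊆ U ∧ ∫ t, g t • κ t ≠ 0 := by
    by_contra! h
    exact hne (hU.ae_eq_zero_of_integral_contDiff_smul_eq_zero hκU h)
  set v := ∫ t, g t • κ t with hv_def
  have hzero : ∀ t ∉ U, g t = 0 := fun t ht =>
    image_eq_zero_of_notMem_tsupport fun h => ht (hgU h)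
  have hint : Integrable (fun t => g t • κ t) := by
    have hK : IntegrableOn κ (tsupport g) :=
      (hκU.mono_set hgU).integrableOn_isCompact hgc
    have := hK.continuousOn_smul hg.continuous.continuousOn hgc
    refine (integrableOn_iff_integrable_of_support_subset ?_).1 this
    exact (Function.support_smul_subset_left _ _).trans (subset_tsupport g)
  refine ⟨fun t => g t • ((‖v‖ ^ 2)⁻¹ • v), ⟨?_, ?_, ?_⟩, ?_, ?_⟩
  · exact hg.smul contDiff_const
  · exact hgc.smul_right
  · exact (tsupport_smul_subset_left _ _).trans (hgU.trans hUI)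
  · intro t ht
    simp [hzero t ht]
  · have h1 : ∀ t, ⟪κ t, g t • ((‖v‖ ^ 2)⁻¹ • v)⟫ = ⟪(‖v‖ ^ 2)⁻¹ • v, g t • κ t⟫ := by
      intro t
      rw [real_inner_comm, inner_smul_left, inner_smul_right]
      simp
    rw [setIntegral_eq_integral_of_forall_compl_eq_zero
      fun t ht => by simp [hzero t fun h => ht (hUI h)]]
    simp_rw [h1]
    rw [integral_inner hint, ← hv_def, real_inner_smul_left, real_inner_self_eq_norm_sq]
    exact inv_mul_cancel₀ (by simpa using hv)

/-- Let `I ⊆ ℝ` be an interval with non-empty interior and `κ : I → ℝ^d` locally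
integrable.  If the linear functional `H(f) = ∫_I ⟪κ(t), f(t)⟫ dt` on `C_c^∞(I, ℝ^d)` is
(sequentially) continuous with respect to pointwise convergence, then `κ = 0` Lebesgue-a.e.
on `I` and `H` is identically zero. -/
theorem stmt18 {d : ℕ} (I : Set ℝ) (hI : I.OrdConnected) (hint : (interior I).Nonempty)
    (κ : ℝ → EuclideanSpace ℝ (Fin d))
    (hκ : LocallyIntegrableOn κ I volume)
    (hcont : ∀ (f : ℕ → ℝ → EuclideanSpace ℝ (Fin d)) (g : ℝ → EuclideanSpace ℝ (Fin d)),
      (∀ n, IsTestFun I (f n)) → IsTestFun I g →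
      (∀ t : ℝ, Tendsto (fun n => f n t) atTop (nhds (g t))) →
      Tendsto (fun n => ∫ t in I, ⟪κ t, f n t⟫) atTop (nhds (∫ t in I, ⟪κ t, g t⟫))) :
    (∀ᵐ t ∂(volume.restrict I), κ t = 0) ∧
    ∀ f : ℝ → EuclideanSpace ℝ (Fin d), IsTestFun I f → (∫ t in I, ⟪κ t, f t⟫) = 0 := by
  have hloc : ∀ x ∈ interior I, ∃ r > 0, ∀ᵐ t ∂volume,
      t ∈ interior I ∩ (Metric.ball x r \ {x}) → κ t = 0 := by
    intro x hx
    by_contra hc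
    have hex : ∀ n : ℕ, ∃ f : ℝ → EuclideanSpace ℝ (Fin d), IsTestFun I f ∧
        (∀ t ∉ interior I ∩ (Metric.ball x (1 / ((n : ℝ) + 1)) \ {x}), f t = 0) ∧
        ∫ t in I, ⟪κ t, f t⟫ = 1 := fun n =>
      exists_isTestFun_integral_inner_eq_one
        (isOpen_interior.inter (Metric.isOpen_ball.sdiff isClosed_singleton))
        (Set.inter_subset_left.trans interior_subset) hκ
        (fun h => hc ⟨_, Nat.one_div_pos_of_nat, h⟩)
    choose f hf hf0 hf1 using hex
    have hlim := hcont f 0 hf ⟨contDiff_const, HasCompactSupport.zero, by simp [tsupport]⟩ <| by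
      intro t
      refine tendsto_const_nhds.congr' ?_
      rcases eq_or_ne t x with rfl | htx
      · exact Eventually.of_forall fun n => (hf0 n t (by simp)).symm
      · filter_upwards [tendsto_one_div_add_atTop_nhds_zero_nat.eventually_lt_const
          (dist_pos.2 htx)] with n hn
        exact (hf0 n t fun h => lt_asymm hn h.2.1).symm
    simp only [hf1, Pi.zero_apply, inner_zero_right, integral_zero] at hlim
    exact one_ne_zero (tendsto_nhds_unique tendsto_const_nhds hlim)
  have hnull : volume {t ∈ interior I | κ t ≠ 0} = 0 := by
    refine measure_null_of_locally_null _ fun x hx => ?_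
    obtain ⟨r, hr, h⟩ := hloc x hx.1
    refine ⟨{t ∈ interior I | κ t ≠ 0} ∩ Metric.ball x r,
      inter_mem_nhdsWithin _ (Metric.ball_mem_nhds x hr), ?_⟩
    refine measure_mono_null ?_
      (measure_union_null (ae_iff.1 h) (Real.volume_singleton (a := x)))
    rintro t ⟨⟨htI, ht⟩, htr⟩
    by_cases htx : t = x
    · exact Or.inr htx
    · exact Or.inl fun h => ht (h ⟨htI, htr, htx⟩)
  have hae : ∀ᵐ t ∂(volume.restrict I), κ t = 0 := by
    rw [ae_restrict_iff' hI.measurableSet, ae_iff]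
    refine measure_mono_null ?_
      (measure_union_null hnull (hI.convex.addHaar_frontier volume))
    intro t ht
    obtain ⟨htI, ht0⟩ := Classical.not_imp.1 ht
    by_cases h : t ∈ interior I
    · exact Or.inl ⟨h, ht0⟩
    · exact Or.inr ⟨subset_closure htI, h⟩
  refine ⟨hae, fun f _ => integral_eq_zero_of_ae ?_⟩
  filter_upwards [hae] with t ht
  simp [ht]
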